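/- Let n ≥ 2 be an integer, p > 1 with p' = p/(p-1), ε > 0, and let s₀ > 0 be such that (n-1)s ≤ n ω_n (sinh F(s))^{n-1} ≤ (1+ε)(n-1)s for all s ≥ s₀. For R > s₀ define f_R : (0,∞) → [0,∞) by f_R(s) = s₀^{-1/p} for s ∈ (0,s₀), f_R(s) = s^{-1/p} for s ∈ [s₀,R), and f_R(s) = R^{-1/p} max{2 - s/R, 0} for s ≥ R; set v_{R,0} = f_R and, for i ≥ 0, v_{R,i+1}(s) = ∫_s^∞ (t / (n ω_n (sinh F(t))^{n-1})²) · ((1/t) ∫_0^t v_{R,i}(τ) dτ) dt. Then for each integer i ≥ 1 there exists a constant C > 0 depending only on n, p, ε, s₀ and i (not on R) such that for every R > s₀ one can write v_{R,i} = h_{R,i} + w_{R,i} with ∫_0^∞ |w_{R,i}(s)|^p ds ≤ C and (1+ε)^{-2i} (p p'/(n-1)²)^i f_R(s) ≤ h_{R,i}(s) ≤ (p p'/(n-1)²)^i f_R(s) for all s > 0. -/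

import Mathlib

open MeasureTheory

/-- `ω_n`: the Lebesgue volume of the unit ball in `ℝ^n`. -/
noncomputable def unitBallVol (n : ℕ) : ℝ :=
  (volume (Metric.ball (0 : EuclideanSpace ℝ (Fin n)) 1)).toReal

/-- The test function `f_R`: `s₀^{-1/p}` on `(0,s₀)`, `s^{-1/p}` on `[s₀,R)`, and
`R^{-1/p} max{2 - s/R, 0}` on `[R,∞)`. -/
noncomputable def fTest (p s₀ R s : ℝ) : ℝ :=
  if s < s₀ then s₀ ^ (-(1 / p))
  else if s < R then s ^ (-(1 / p))
  else R ^ (-(1 / p)) * max (2 - s / R) 0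

/-- The iterates `v_{R,i}`: `v_{R,0} = f_R` and
`v_{R,i+1}(s) = ∫_s^∞ (t/(nω_n (sinh F(t))^{n-1})²) ((1/t)∫_0^t v_{R,i}) dt`. -/
noncomputable def vIter (n : ℕ) (p : ℝ) (F : ℝ → ℝ) (s₀ R : ℝ) : ℕ → ℝ → ℝ
  | 0 => fTest p s₀ R
  | i + 1 => fun s => ∫ t in Set.Ioi s,
      t / (n * unitBallVol n * Real.sinh (F t) ^ (n - 1)) ^ 2 *
        ((1 / t) * ∫ τ in Set.Ioo (0 : ℝ) t, vIter n p F s₀ R i τ)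

open Set

/-- The weighted iterated integral operator `v ↦ ∫_s^∞ (t/A(t)²) ((1/t)∫_0^t v) dt`. -/
noncomputable def hardyOp (A v : ℝ → ℝ) (s : ℝ) : ℝ :=
  ∫ t in Ioi s, t / A t ^ 2 * ((1 / t) * ∫ τ in Ioo (0 : ℝ) t, v τ)

lemma integrableOn_Ioo_rpow_neg {γ t : ℝ} (hγ : γ < 1) (ht : 0 < t) :
    IntegrableOn (fun τ : ℝ => τ ^ (-γ)) (Ioo 0 t) :=
  (intervalIntegral.integrableOn_Ioo_rpow_iff ht).2 (by linarith)

lemma integral_Ioo_rpow_neg {γ t : ℝ} (hγ : γ < 1) (ht : 0 < t) :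
    ∫ τ in Ioo (0 : ℝ) t, τ ^ (-γ) = t ^ (1 - γ) / (1 - γ) := by
  rw [← integral_Ioc_eq_integral_Ioo, ← intervalIntegral.integral_of_le ht.le,
    integral_rpow (Or.inl (by linarith)), neg_add_eq_sub, Real.zero_rpow (by linarith), sub_zero]

lemma integral_Ioi_rpow_neg {γ s : ℝ} (hγ : 0 < γ) (hs : 0 < s) :
    ∫ t in Ioi s, t ^ (-1 - γ) = s ^ (-γ) / γ := by
  rw [integral_Ioi_rpow_of_lt (by linarith) hs, show -1 - γ + 1 = -γ by ring, neg_div_neg_eq]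

lemma integral_sub_sub {μ : Measure ℝ} {f g h : ℝ → ℝ} (hf : Integrable f μ)
    (hg : Integrable g μ) (hh : Integrable h μ) :
    ∫ x, (f x - g x - h x) ∂μ = ∫ x, f x ∂μ - ∫ x, g x ∂μ - ∫ x, h x ∂μ := by
  rw [← integral_sub hf hg]
  exact integral_sub (hf.sub hg) hh

section HardyOp

variable {A v : ℝ → ℝ} {m C γ : ℝ}

lemma integrableOn_Ioo_of_le_rpow (hγ : γ < 1)
    (hv : AEMeasurable v (volume.restrict (Ioi 0))) (hv0 : ∀ s > 0, 0 ≤ v s)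
    (hvC : ∀ s > 0, v s ≤ C * s ^ (-γ)) {t : ℝ} (ht : 0 < t) : IntegrableOn v (Ioo 0 t) := by
  refine ((integrableOn_Ioo_rpow_neg hγ ht).const_mul C).mono'
    (hv.mono_measure (Measure.restrict_mono Ioo_subset_Ioi_self le_rfl)).aestronglyMeasurable ?_
  filter_upwards [ae_restrict_mem measurableSet_Ioo] with s hs
  rw [Real.norm_of_nonneg (hv0 s hs.1)]
  exact hvC s hs.1

lemma setIntegral_Ioo_le_rpow (hγ : γ < 1)
    (hv : AEMeasurable v (volume.restrict (Ioi 0))) (hv0 : ∀ s > 0, 0 ≤ v s)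
    (hvC : ∀ s > 0, v s ≤ C * s ^ (-γ)) {t : ℝ} (ht : 0 < t) :
    ∫ τ in Ioo (0 : ℝ) t, v τ ≤ C * (t ^ (1 - γ) / (1 - γ)) := by
  rw [← integral_Ioo_rpow_neg hγ ht, ← integral_const_mul]
  exact setIntegral_mono_on (integrableOn_Ioo_of_le_rpow hγ hv hv0 hvC ht)
    ((integrableOn_Ioo_rpow_neg hγ ht).const_mul C) measurableSet_Ioo fun s hs => hvC s hs.1

lemma setIntegral_Ioo_nonneg (hv0 : ∀ s > 0, 0 ≤ v s) (t : ℝ) :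
    0 ≤ ∫ τ in Ioo (0 : ℝ) t, v τ :=
  setIntegral_nonneg measurableSet_Ioo fun s hs => hv0 s hs.1

lemma hardyOp_integrand_nonneg (hv0 : ∀ s > 0, 0 ≤ v s) {t : ℝ} (ht : 0 < t) :
    0 ≤ t / A t ^ 2 * ((1 / t) * ∫ τ in Ioo (0 : ℝ) t, v τ) := by
  have := setIntegral_Ioo_nonneg hv0 t
  positivity

lemma rpow_div_sq {t : ℝ} (γ : ℝ) (ht : 0 < t) : t ^ (1 - γ) / t ^ 2 = t ^ (-1 - γ) := by
  rw [← Real.rpow_natCast t 2, ← Real.rpow_sub ht]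
  norm_num
  ring_nf

lemma hardyOp_integrand_le (hm : 0 < m) (hA : ∀ t > 0, m * t ≤ A t) (hγ : γ < 1)
    (hv : AEMeasurable v (volume.restrict (Ioi 0))) (hv0 : ∀ s > 0, 0 ≤ v s)
    (hvC : ∀ s > 0, v s ≤ C * s ^ (-γ)) {t : ℝ} (ht : 0 < t) :
    t / A t ^ 2 * ((1 / t) * ∫ τ in Ioo (0 : ℝ) t, v τ)
      ≤ C / ((1 - γ) * m ^ 2) * t ^ (-1 - γ) := by
  have h1 := setIntegral_Ioo_le_rpow hγ hv hv0 hvC ht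
  have h0 := setIntegral_Ioo_nonneg hv0 t
  have hmt : 0 < m * t := by positivity
  calc t / A t ^ 2 * ((1 / t) * ∫ τ in Ioo (0 : ℝ) t, v τ)
      = (∫ τ in Ioo (0 : ℝ) t, v τ) / A t ^ 2 := by field_simp
    _ ≤ (∫ τ in Ioo (0 : ℝ) t, v τ) / (m * t) ^ 2 := by
        gcongr
        exact hA t ht
    _ ≤ (C * (t ^ (1 - γ) / (1 - γ))) / (m * t) ^ 2 := by gcongr
    _ = C / ((1 - γ) * m ^ 2) * (t ^ (1 - γ) / t ^ 2) := by
        have : 1 - γ ≠ 0 := by linarith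
        field_simp
    _ = _ := by rw [rpow_div_sq γ ht]

lemma integrableOn_hardyOp_integrand (hm : 0 < m) (hA : ∀ t > 0, m * t ≤ A t)
    (hAmono : MonotoneOn A (Ioi 0)) (hγ0 : 0 < γ) (hγ : γ < 1)
    (hv : AEMeasurable v (volume.restrict (Ioi 0))) (hv0 : ∀ s > 0, 0 ≤ v s)
    (hvC : ∀ s > 0, v s ≤ C * s ^ (-γ)) {s : ℝ} (hs : 0 < s) :
    IntegrableOn (fun t => t / A t ^ 2 * ((1 / t) * ∫ τ in Ioo (0 : ℝ) t, v τ)) (Ioi s) := by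
  have hI : MonotoneOn (fun t => ∫ τ in Ioo (0 : ℝ) t, v τ) (Ioi 0) := by
    intro x hx y hy hxy
    refine setIntegral_mono_set (integrableOn_Ioo_of_le_rpow hγ hv hv0 hvC hy) ?_
      (Ioo_subset_Ioo_right hxy).eventuallyLE
    filter_upwards [ae_restrict_mem measurableSet_Ioo] with t ht using hv0 t ht.1
  have hmeas : AEMeasurable (fun t => t / A t ^ 2 * ((1 / t) * ∫ τ in Ioo (0 : ℝ) t, v τ))
      (volume.restrict (Ioi 0)) := by
    have h1 := aemeasurable_restrict_of_monotoneOn (μ := volume) measurableSet_Ioi hAmono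
    have h2 := aemeasurable_restrict_of_monotoneOn (μ := volume) measurableSet_Ioi hI
    exact (aemeasurable_id.div (h1.pow_const 2)).mul ((aemeasurable_const.div aemeasurable_id).mul h2)
  refine ((integrableOn_Ioi_rpow_of_lt (a := -1 - γ) (by linarith) hs).const_mul
    (C / ((1 - γ) * m ^ 2))).mono' (hmeas.mono_measure
      (Measure.restrict_mono (Ioi_subset_Ioi hs.le) le_rfl)).aestronglyMeasurable ?_
  filter_upwards [ae_restrict_mem measurableSet_Ioi] with t ht
  have ht0 : 0 < t := hs.trans ht
  rw [Real.norm_of_nonneg (hardyOp_integrand_nonneg hv0 ht0)]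
  exact hardyOp_integrand_le hm hA hγ hv hv0 hvC ht0

lemma hardyOp_nonneg (hv0 : ∀ s > 0, 0 ≤ v s) {s : ℝ} (hs : 0 < s) : 0 ≤ hardyOp A v s :=
  setIntegral_nonneg measurableSet_Ioi fun _ ht => hardyOp_integrand_nonneg hv0 (hs.trans ht)

lemma hardyOp_le_rpow (hm : 0 < m) (hA : ∀ t > 0, m * t ≤ A t)
    (hAmono : MonotoneOn A (Ioi 0)) (hγ0 : 0 < γ) (hγ : γ < 1)
    (hv : AEMeasurable v (volume.restrict (Ioi 0))) (hv0 : ∀ s > 0, 0 ≤ v s)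
    (hvC : ∀ s > 0, v s ≤ C * s ^ (-γ)) {s : ℝ} (hs : 0 < s) :
    hardyOp A v s ≤ C / (γ * (1 - γ) * m ^ 2) * s ^ (-γ) := by
  calc hardyOp A v s ≤ ∫ t in Ioi s, C / ((1 - γ) * m ^ 2) * t ^ (-1 - γ) :=
        setIntegral_mono_on (integrableOn_hardyOp_integrand hm hA hAmono hγ0 hγ hv hv0 hvC hs)
          ((integrableOn_Ioi_rpow_of_lt (by linarith) hs).const_mul _) measurableSet_Ioi
          fun t ht => hardyOp_integrand_le hm hA hγ hv hv0 hvC (hs.trans ht)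
    _ = _ := by
        rw [integral_const_mul, integral_Ioi_rpow_neg hγ0 hs]
        have : 1 - γ ≠ 0 := by linarith
        field_simp

lemma antitoneOn_hardyOp (hm : 0 < m) (hA : ∀ t > 0, m * t ≤ A t)
    (hAmono : MonotoneOn A (Ioi 0)) (hγ0 : 0 < γ) (hγ : γ < 1)
    (hv : AEMeasurable v (volume.restrict (Ioi 0))) (hv0 : ∀ s > 0, 0 ≤ v s)
    (hvC : ∀ s > 0, v s ≤ C * s ^ (-γ)) : AntitoneOn (hardyOp A v) (Ioi 0) := by
  intro x hx y _ hxy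
  refine setIntegral_mono_set (integrableOn_hardyOp_integrand hm hA hAmono hγ0 hγ hv hv0 hvC hx) ?_
    (Ioi_subset_Ioi hxy).eventuallyLE
  filter_upwards [ae_restrict_mem measurableSet_Ioi] with t ht
  exact hardyOp_integrand_nonneg hv0 (lt_trans hx ht)

/-- A lower bound for `v` by a combination of powers is inherited by `hardyOp A v` on the range
where `A` is bounded above linearly. -/
lemma le_hardyOp {M s₀ α β a b c : ℝ} (hm : 0 < m) (hM : 0 < M) (hA : ∀ t > 0, m * t ≤ A t)
    (hAmono : MonotoneOn A (Ioi 0)) (hs₀ : 0 < s₀) (hAM : ∀ t, s₀ ≤ t → A t ≤ M * t)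
    (hγ0 : 0 < γ) (hγ : γ < 1) (hα0 : 0 < α) (hα : α < 1) (hβ0 : 0 < β) (hβ : β < 1)
    (hv : AEMeasurable v (volume.restrict (Ioi 0))) (hv0 : ∀ s > 0, 0 ≤ v s)
    (hvC : ∀ s > 0, v s ≤ C * s ^ (-γ))
    (hvlow : ∀ s > 0, a * s ^ (-γ) - b * s ^ (-β) - c * s ^ (-α) ≤ v s)
    {s : ℝ} (hs : s₀ ≤ s) :
    a / (γ * (1 - γ) * M ^ 2) * s ^ (-γ) - b / (β * (1 - β) * M ^ 2) * s ^ (-β)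
      - c / (α * (1 - α) * M ^ 2) * s ^ (-α) ≤ hardyOp A v s := by
  have hs' : 0 < s := hs₀.trans_le hs
  have hγ1 : 1 - γ ≠ 0 := by linarith
  have hα1 : 1 - α ≠ 0 := by linarith
  have hβ1 : 1 - β ≠ 0 := by linarith
  have hint : ∀ {δ : ℝ} (d : ℝ), 0 < δ → IntegrableOn (fun t : ℝ => d * t ^ (-1 - δ)) (Ioi s) :=
    fun d hδ => (integrableOn_Ioi_rpow_of_lt (by linarith) hs').const_mul d
  have hlow : ∀ t > 0, a * (t ^ (1 - γ) / (1 - γ)) - b * (t ^ (1 - β) / (1 - β))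
      - c * (t ^ (1 - α) / (1 - α)) ≤ ∫ τ in Ioo (0 : ℝ) t, v τ := by
    intro t ht
    have hi : ∀ {δ : ℝ} (d : ℝ), δ < 1 → IntegrableOn (fun t : ℝ => d * t ^ (-δ)) (Ioo 0 t) :=
      fun d hδ => (integrableOn_Ioo_rpow_neg hδ ht).const_mul d
    rw [← integral_Ioo_rpow_neg hγ ht, ← integral_Ioo_rpow_neg hβ ht,
      ← integral_Ioo_rpow_neg hα ht, ← integral_const_mul, ← integral_const_mul,
      ← integral_const_mul, ← integral_sub_sub (hi a hγ) (hi b hβ) (hi c hα)]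
    exact setIntegral_mono_on (((hi a hγ).sub (hi b hβ)).sub (hi c hα))
      (integrableOn_Ioo_of_le_rpow hγ hv hv0 hvC ht) measurableSet_Ioo fun s hs => hvlow s hs.1
  calc _ = ∫ t in Ioi s, (a / ((1 - γ) * M ^ 2) * t ^ (-1 - γ)
          - b / ((1 - β) * M ^ 2) * t ^ (-1 - β) - c / ((1 - α) * M ^ 2) * t ^ (-1 - α)) := by
        rw [integral_sub_sub (hint _ hγ0) (hint _ hβ0) (hint _ hα0), integral_const_mul,
          integral_const_mul, integral_const_mul, integral_Ioi_rpow_neg hγ0 hs', integral_Ioi_rpow_neg hβ0 hs',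
          integral_Ioi_rpow_neg hα0 hs']
        field_simp
    _ ≤ _ := by
        refine setIntegral_mono_on (((hint _ hγ0).sub (hint _ hβ0)).sub (hint _ hα0))
          (integrableOn_hardyOp_integrand hm hA hAmono hγ0 hγ hv hv0 hvC hs') measurableSet_Ioi ?_
        intro t ht
        have hst : s₀ ≤ t := hs.trans (le_of_lt ht)
        have ht0 : 0 < t := hs₀.trans_le hst
        have hAt : 0 < A t := (mul_pos hm ht0).trans_le (hA t ht0)
        have h0 := setIntegral_Ioo_nonneg hv0 t
        calc _ = (a * (t ^ (1 - γ) / (1 - γ)) - b * (t ^ (1 - β) / (1 - β))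
              - c * (t ^ (1 - α) / (1 - α))) / (M * t) ^ 2 := by
              simp only [← rpow_div_sq _ ht0]
              field_simp
          _ ≤ (∫ τ in Ioo (0 : ℝ) t, v τ) / (M * t) ^ 2 := by
              gcongr
              exact hlow t ht0
          _ ≤ (∫ τ in Ioo (0 : ℝ) t, v τ) / A t ^ 2 := by
              gcongr
              exact hAM t hst
          _ = _ := by field_simp

end HardyOp

section Weight

lemma unitBallVol_pos (n : ℕ) : 0 < unitBallVol n :=
  ENNReal.toReal_pos (Metric.measure_ball_pos _ _ one_pos).ne' measure_ball_lt_top.ne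

variable {n : ℕ} {F : ℝ → ℝ}

lemma monotoneOn_weight (hn : 2 ≤ n) (hF0 : ∀ s, 0 ≤ s → 0 ≤ F s)
    (hF : ∀ s, 0 ≤ s →
      s = n * unitBallVol n * ∫ r in (0 : ℝ)..(F s), Real.sinh r ^ (n - 1)) :
    MonotoneOn (fun t => n * unitBallVol n * Real.sinh (F t) ^ (n - 1)) (Ioi 0) := by
  have hω : 0 < n * unitBallVol n := mul_pos (by positivity) (unitBallVol_pos n)
  intro x hx y hy hxy
  have hFxy : F x ≤ F y := by
    by_contra! hlt
    have hint : (∫ r in (0 : ℝ)..(F y), Real.sinh r ^ (n - 1))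
        ≤ ∫ r in (0 : ℝ)..(F x), Real.sinh r ^ (n - 1) := by
      refine intervalIntegral.integral_mono_interval le_rfl (hF0 y (le_of_lt hy)) hlt.le ?_
        (Continuous.intervalIntegrable (by fun_prop) _ _)
      filter_upwards [ae_restrict_mem measurableSet_Ioc] with r hr
      exact pow_nonneg (Real.sinh_nonneg_iff.2 hr.1.le) _
    have hyx : y ≤ x := by
      rw [hF x (le_of_lt hx), hF y (le_of_lt hy)]
      gcongr
    rw [le_antisymm hxy hyx] at hlt
    exact lt_irrefl _ hlt
  have hx0 : 0 ≤ Real.sinh (F x) := Real.sinh_nonneg_iff.2 (hF0 x (le_of_lt hx))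
  have := Real.sinh_le_sinh.2 hFxy
  simp only
  gcongr

lemma le_weight (hn : 2 ≤ n) (hF0 : ∀ s, 0 ≤ s → 0 ≤ F s)
    (hF : ∀ s, 0 ≤ s →
      s = n * unitBallVol n * ∫ r in (0 : ℝ)..(F s), Real.sinh r ^ (n - 1)) {t : ℝ} (ht : 0 ≤ t) :
    ((n : ℝ) - 1) * t ≤ n * unitBallVol n * Real.sinh (F t) ^ (n - 1) := by
  have hω : 0 < n * unitBallVol n := mul_pos (by positivity) (unitBallVol_pos n)
  obtain ⟨k, rfl⟩ : ∃ k, n = k + 2 := ⟨n - 2, by omega⟩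
  have hder : ∀ x ∈ uIcc 0 (F t), HasDerivAt (fun r => Real.sinh r ^ (k + 1))
      (((k + 1 : ℕ) : ℝ) * Real.sinh x ^ k * Real.cosh x) x := fun x _ =>
    (Real.hasDerivAt_sinh x).fun_pow (k + 1)
  have hftc := intervalIntegral.integral_eq_sub_of_hasDerivAt hder
    (Continuous.intervalIntegrable (by fun_prop) _ _)
  have hle : ((k : ℝ) + 1) * ∫ r in (0 : ℝ)..(F t), Real.sinh r ^ (k + 1)
      ≤ Real.sinh (F t) ^ (k + 1) := by
    rw [Real.sinh_zero, zero_pow (Nat.succ_ne_zero k), sub_zero] at hftc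
    rw [← hftc, ← intervalIntegral.integral_const_mul]
    refine intervalIntegral.integral_mono_on (hF0 t ht)
      (Continuous.intervalIntegrable (by fun_prop) _ _)
      (Continuous.intervalIntegrable (by fun_prop) _ _) fun x hx => ?_
    have h0 : 0 ≤ Real.sinh x := Real.sinh_nonneg_iff.2 hx.1
    push_cast
    rw [pow_succ, ← mul_assoc]
    gcongr
    exact (Real.sinh_lt_cosh x).le
  have ht' := hF t ht
  rw [show k + 2 - 1 = k + 1 by omega] at ht' ⊢
  rw [show ((k + 2 : ℕ) : ℝ) - 1 = k + 1 by push_cast; ring]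
  calc ((k : ℝ) + 1) * t = ((k + 2 : ℕ) : ℝ) * unitBallVol (k + 2) *
        (((k : ℝ) + 1) * ∫ r in (0 : ℝ)..(F t), Real.sinh r ^ (k + 1)) := by
        nth_rw 1 [ht']
        ring
    _ ≤ _ := by gcongr

end Weight

section TestFunction

lemma rpow_neg_le_of_le {s ρ γ δ : ℝ} (hs : 0 < s) (hsρ : s ≤ ρ) (hγδ : γ ≤ δ) :
    s ^ (-γ) ≤ ρ ^ (δ - γ) * s ^ (-δ) := by
  rw [show -γ = (δ - γ) + -δ by ring, Real.rpow_add hs]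
  have : s ^ (δ - γ) ≤ ρ ^ (δ - γ) := Real.rpow_le_rpow hs.le hsρ (by linarith)
  gcongr

lemma rpow_neg_le_of_ge {s ρ γ δ : ℝ} (hρ : 0 < ρ) (hsρ : ρ ≤ s) (hγδ : δ ≤ γ) :
    s ^ (-γ) ≤ ρ ^ (δ - γ) * s ^ (-δ) := by
  have hs := hρ.trans_le hsρ
  rw [show -γ = (δ - γ) + -δ by ring, Real.rpow_add hs]
  have : s ^ (δ - γ) ≤ ρ ^ (δ - γ) := Real.rpow_le_rpow_of_nonpos hρ hsρ (by linarith)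
  gcongr

lemma max_two_sub_le_rpow_neg {x β : ℝ} (hx : 1 ≤ x) (hβ : β ≤ 1) :
    max (2 - x) 0 ≤ x ^ (-β) := by
  have hx0 : 0 < x := by linarith
  refine max_le ?_ (Real.rpow_nonneg hx0.le _)
  calc 2 - x ≤ x⁻¹ := by
        rw [← one_div, le_div_iff₀ hx0]
        nlinarith [sq_nonneg (x - 1)]
    _ = x ^ (-1 : ℝ) := (Real.rpow_neg_one x).symm
    _ ≤ x ^ (-β) := Real.rpow_le_rpow_of_exponent_le hx (by linarith)

variable {p s₀ R s α β : ℝ}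

lemma fTest_nonneg (hs₀ : 0 < s₀) (hR : s₀ < R) (hs : 0 < s) : 0 ≤ fTest p s₀ R s := by
  have hR0 := hs₀.trans hR
  unfold fTest
  split_ifs <;> positivity

lemma measurable_fTest : Measurable (fTest p s₀ R) := by
  unfold fTest
  refine Measurable.ite measurableSet_Iio measurable_const
    (Measurable.ite measurableSet_Iio (by fun_prop) (by fun_prop))

lemma fTest_le_upper (hs₀ : 0 < s₀) (hR : s₀ < R) (hs : 0 < s) (hp : 0 ≤ 1 / p)
    (hβp : 1 / p ≤ β) (hβ : β ≤ 1) : fTest p s₀ R s ≤ R ^ (β - 1 / p) * s ^ (-β) := by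
  have hR0 := hs₀.trans hR
  unfold fTest
  split_ifs with h1 h2
  · exact (Real.rpow_le_rpow_of_nonpos hs h1.le (by linarith)).trans
      (rpow_neg_le_of_le hs (h1.trans hR).le hβp)
  · exact rpow_neg_le_of_le hs h2.le hβp
  · push Not at h2
    calc R ^ (-(1 / p)) * max (2 - s / R) 0 ≤ R ^ (-(1 / p)) * (s / R) ^ (-β) := by
          gcongr
          exact max_two_sub_le_rpow_neg ((one_le_div hR0).2 h2) hβ
      _ = R ^ (β - 1 / p) * s ^ (-β) := by
          rw [Real.div_rpow hs.le hR0.le, sub_eq_add_neg, Real.rpow_add hR0,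
            Real.rpow_neg hR0.le β]
          field_simp

lemma fTest_le_rpow (hs₀ : 0 < s₀) (hR : s₀ < R) (hs : 0 < s) (hp : 0 ≤ 1 / p)
    (hp1 : 1 / p ≤ 1) : fTest p s₀ R s ≤ s ^ (-(1 / p)) := by
  simpa using fTest_le_upper (β := 1 / p) hs₀ hR hs hp le_rfl hp1

lemma fTest_le_lower (hs₀ : 0 < s₀) (hR : s₀ < R) (hs : 0 < s) (hp : 0 ≤ 1 / p)
    (hp1 : 1 / p ≤ 1) (hα : 0 ≤ α) (hαp : α ≤ 1 / p) :
    fTest p s₀ R s ≤ s₀ ^ (α - 1 / p) * s ^ (-α) := by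
  rcases lt_or_ge s s₀ with h | h
  · have h1 : s₀ ^ (-α) ≤ s ^ (-α) := Real.rpow_le_rpow_of_nonpos hs h.le (by linarith)
    rw [fTest, if_pos h, show -(1 / p) = (α - 1 / p) + -α by ring, Real.rpow_add hs₀]
    gcongr
  · exact (fTest_le_rpow hs₀ hR hs hp hp1).trans (rpow_neg_le_of_ge hs₀ h hαp)

lemma le_fTest (hs₀ : 0 < s₀) (hR : s₀ < R) (hs : 0 < s) (hαp : α ≤ 1 / p) (hβp : 1 / p ≤ β) :
    s ^ (-(1 / p)) - s₀ ^ (β - 1 / p) * s ^ (-β) - R ^ (α - 1 / p) * s ^ (-α)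
      ≤ fTest p s₀ R s := by
  have hR0 := hs₀.trans hR
  have hf := fTest_nonneg (p := p) hs₀ hR hs
  have h1 : 0 ≤ s₀ ^ (β - 1 / p) * s ^ (-β) := by positivity
  have h2 : 0 ≤ R ^ (α - 1 / p) * s ^ (-α) := by positivity
  rcases lt_or_ge s s₀ with h | h
  · linarith [rpow_neg_le_of_le hs h.le hβp]
  rcases lt_or_ge s R with h' | h'
  · rw [fTest, if_neg h.not_gt, if_pos h']
    linarith
  · linarith [rpow_neg_le_of_ge hR0 h' hαp]

/-- The function equal to a rescaled `s ^ (-α)` below `ρ` and to a rescaled `s ^ (-β)` above `ρ`;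
for `α < 1 / p < β` its `L^p` norm does not depend on `ρ`. -/
noncomputable def brokenPower (p α β ρ s : ℝ) : ℝ :=
  if s < ρ then ρ ^ (α - 1 / p) * s ^ (-α) else ρ ^ (β - 1 / p) * s ^ (-β)

lemma brokenPower_nonneg {ρ : ℝ} (hρ : 0 < ρ) (hs : 0 < s) : 0 ≤ brokenPower p α β ρ s := by
  unfold brokenPower
  split_ifs <;> positivity

lemma measurable_brokenPower {ρ : ℝ} : Measurable (brokenPower p α β ρ) := by
  unfold brokenPower
  exact Measurable.ite measurableSet_Iio (by fun_prop) (by fun_prop)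

lemma lintegral_brokenPower_rpow {ρ : ℝ} (hp : 0 < p) (hρ : 0 < ρ) (hα : α * p < 1)
    (hβ : 1 < β * p) :
    ∫⁻ s in Ioi 0, ENNReal.ofReal (brokenPower p α β ρ s ^ p)
      ≤ ENNReal.ofReal (1 / (1 - α * p) + 1 / (β * p - 1)) := by
  have hpow : ∀ δ : ℝ, ∀ s > 0, (ρ ^ (δ - 1 / p) * s ^ (-δ)) ^ p
      = ρ ^ (δ * p - 1) * s ^ (-(δ * p)) := by
    intro δ s hs
    rw [Real.mul_rpow (by positivity) (by positivity), ← Real.rpow_mul hρ.le, ← Real.rpow_mul hs.le]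
    congr 2 <;> field_simp
  rw [← Ioo_union_Ici_eq_Ioi hρ, ENNReal.ofReal_add (by bound) (by bound)]
  refine (lintegral_union_le _ _ _).trans (add_le_add (le_of_eq ?_) (le_of_eq ?_))
  · rw [setLIntegral_congr_fun (g := fun s => ENNReal.ofReal (ρ ^ (α * p - 1) * s ^ (-(α * p))))
      measurableSet_Ioo (fun s hs => by rw [brokenPower, if_pos hs.2, hpow α s hs.1]),
      ← ofReal_integral_eq_lintegral_ofReal ((integrableOn_Ioo_rpow_neg hα hρ).const_mul _),
      integral_const_mul, integral_Ioo_rpow_neg hα hρ, mul_div_assoc', ← Real.rpow_add hρ]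
    · simp
    · filter_upwards [ae_restrict_mem measurableSet_Ioo] with s hs
      have := hs.1
      positivity
  · have hγ : 0 < β * p - 1 := by linarith
    rw [setLIntegral_congr_fun
      (g := fun s => ENNReal.ofReal (ρ ^ (β * p - 1) * s ^ (-1 - (β * p - 1))))
      measurableSet_Ici (fun s hs => by
        rw [brokenPower, if_neg (not_lt.2 hs), hpow β s (hρ.trans_le hs)]
        ring_nf),
      ← setLIntegral_congr Ioi_ae_eq_Ici,
      ← ofReal_integral_eq_lintegral_ofReal
        ((integrableOn_Ioi_rpow_of_lt (by linarith) hρ).const_mul _),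
      integral_const_mul, integral_Ioi_rpow_neg hγ hρ, mul_div_assoc', ← Real.rpow_add hρ]
    · simp
    · filter_upwards [ae_restrict_mem measurableSet_Ioi] with s hs
      have := hρ.trans hs
      positivity

end TestFunction

section Iterates

variable {A : ℝ → ℝ} {p m M s₀ α β : ℝ}

lemma iterate_hardyOp_bounds (hp : 1 < p) (hm : 0 < m) (hM : 0 < M)
    (hA : ∀ t > 0, m * t ≤ A t) (hAmono : MonotoneOn A (Ioi 0)) (hs₀ : 0 < s₀)
    (hAM : ∀ t, s₀ ≤ t → A t ≤ M * t) (hα0 : 0 < α) (hα : α < 1 / p) (hβ : 1 / p < β)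
    (hβ1 : β < 1) (i : ℕ) :
    ∃ N ≥ 0, ∀ R > s₀, AEMeasurable ((hardyOp A)^[i] (fTest p s₀ R)) (volume.restrict (Ioi 0)) ∧
      ∀ s > 0, 0 ≤ (hardyOp A)^[i] (fTest p s₀ R) s ∧
        (hardyOp A)^[i] (fTest p s₀ R) s
          ≤ (1 / (1 / p * (1 - 1 / p) * m ^ 2)) ^ i * s ^ (-(1 / p)) ∧
        (hardyOp A)^[i] (fTest p s₀ R) s
          ≤ (1 / (α * (1 - α) * m ^ 2)) ^ i * s₀ ^ (α - 1 / p) * s ^ (-α) ∧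
        (hardyOp A)^[i] (fTest p s₀ R) s
          ≤ (1 / (β * (1 - β) * m ^ 2)) ^ i * R ^ (β - 1 / p) * s ^ (-β) ∧
        (1 / (1 / p * (1 - 1 / p) * M ^ 2)) ^ i * s ^ (-(1 / p))
          - N * s₀ ^ (β - 1 / p) * s ^ (-β) - N * R ^ (α - 1 / p) * s ^ (-α)
          ≤ (hardyOp A)^[i] (fTest p s₀ R) s := by
  have hp0 : 0 < 1 / p := by positivity
  have hp1 : 1 / p < 1 := hβ.trans hβ1
  have hα1 : α < 1 := hα.trans hp1
  have hβ0 : 0 < β := hp0.trans hβ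
  induction i with
  | zero =>
    refine ⟨1, zero_le_one, fun R hR => ⟨measurable_fTest.aemeasurable, fun s hs => ?_⟩⟩
    simp only [Function.iterate_zero, id, pow_zero, one_mul]
    exact ⟨fTest_nonneg hs₀ hR hs, fTest_le_rpow hs₀ hR hs hp0.le hp1.le,
      fTest_le_lower hs₀ hR hs hp0.le hp1.le hα0.le hα.le,
      fTest_le_upper hs₀ hR hs hp0.le hβ.le hβ1.le, le_fTest hs₀ hR hs hα.le hβ.le⟩
  | succ i ih =>
    obtain ⟨N, hN, ih⟩ := ih
    have h1p : 0 < 1 - 1 / p := by linarith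
    have h1α : 0 < 1 - α := by linarith
    have h1β : 0 < 1 - β := by linarith
    set L := 1 / (1 / p * (1 - 1 / p) * M ^ 2) with hL
    have hL0 : 0 < L := by positivity
    have hNβ : 0 ≤ N / (β * (1 - β) * M ^ 2) := by positivity
    have hNα : 0 ≤ N / (α * (1 - α) * M ^ 2) := by positivity
    have hLi : 0 < L ^ (i + 1) := by positivity
    refine ⟨N / (β * (1 - β) * M ^ 2) + N / (α * (1 - α) * M ^ 2) + L ^ (i + 1), by positivity,
      fun R hR => ?_⟩
    have hR0 : 0 < R := hs₀.trans hR
    obtain ⟨hv, hb⟩ := ih R hR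
    simp only [Function.iterate_succ_apply']
    set v := (hardyOp A)^[i] (fTest p s₀ R)
    have hv0 : ∀ s > 0, 0 ≤ v s := fun s hs => (hb s hs).1
    have hvp := fun s hs => (hb s hs).2.1
    refine ⟨aemeasurable_restrict_of_antitoneOn measurableSet_Ioi
      (antitoneOn_hardyOp hm hA hAmono hp0 hp1 hv hv0 hvp), fun s hs => ?_⟩
    refine ⟨hardyOp_nonneg hv0 hs, ?_, ?_, ?_, ?_⟩
    · refine (hardyOp_le_rpow hm hA hAmono hp0 hp1 hv hv0 hvp hs).trans_eq ?_
      rw [pow_succ]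
      ring
    · refine (hardyOp_le_rpow hm hA hAmono hα0 hα1 hv hv0
        (fun s hs => (hb s hs).2.2.1) hs).trans_eq ?_
      rw [pow_succ]
      ring
    · refine (hardyOp_le_rpow hm hA hAmono hβ0 hβ1 hv hv0
        (fun s hs => (hb s hs).2.2.2.1) hs).trans_eq ?_
      rw [pow_succ]
      ring
    · have hX : 0 ≤ s₀ ^ (β - 1 / p) * s ^ (-β) := by positivity
      have hY : 0 ≤ R ^ (α - 1 / p) * s ^ (-α) := by positivity
      rcases lt_or_ge s s₀ with h | h
      · have h1 := mul_le_mul_of_nonneg_left (rpow_neg_le_of_le hs h.le hβ.le) hLi.le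
        have h2 := hardyOp_nonneg (A := A) hv0 hs
        nlinarith [mul_nonneg hNβ hX, mul_nonneg hNα hX, mul_nonneg hNβ hY, mul_nonneg hNα hY,
          mul_nonneg hLi.le hY]
      · have h1 := le_hardyOp hm hM hA hAmono hs₀ hAM hp0 hp1 hα0 hα1 hβ0 hβ1 hv hv0 hvp
          (fun s hs => (hb s hs).2.2.2.2) h
        have h2 : L ^ i / (1 / p * (1 - 1 / p) * M ^ 2) = L ^ (i + 1) := by
          rw [pow_succ, hL]
          ring
        have h3 : N * s₀ ^ (β - 1 / p) / (β * (1 - β) * M ^ 2) * s ^ (-β)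
            = N / (β * (1 - β) * M ^ 2) * (s₀ ^ (β - 1 / p) * s ^ (-β)) := by ring
        have h4 : N * R ^ (α - 1 / p) / (α * (1 - α) * M ^ 2) * s ^ (-α)
            = N / (α * (1 - α) * M ^ 2) * (R ^ (α - 1 / p) * s ^ (-α)) := by ring
        rw [h2, h3, h4] at h1
        nlinarith [mul_nonneg hNβ hX, mul_nonneg hNα hX, mul_nonneg hNβ hY, mul_nonneg hNα hY,
          mul_nonneg hLi.le hY, mul_nonneg hLi.le hX]

/-- The iterates stay between multiples of `fTest` up to an error controlled by two broken powers:
the error left after truncating the iterate to the target interval. -/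
lemma exists_abs_sub_clamp_le (hp : 1 < p) (hm : 0 < m) (hmM : m ≤ M)
    (hA : ∀ t > 0, m * t ≤ A t) (hAmono : MonotoneOn A (Ioi 0)) (hs₀ : 0 < s₀)
    (hAM : ∀ t, s₀ ≤ t → A t ≤ M * t) (hα0 : 0 < α) (hα : α < 1 / p) (hβ : 1 / p < β)
    (hβ1 : β < 1) (i : ℕ) :
    ∃ N ≥ 0, ∀ R > s₀, ∃ h : ℝ → ℝ, ∀ s > 0,
      (1 / (1 / p * (1 - 1 / p) * M ^ 2)) ^ i * fTest p s₀ R s ≤ h s ∧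
      h s ≤ (1 / (1 / p * (1 - 1 / p) * m ^ 2)) ^ i * fTest p s₀ R s ∧
      |(hardyOp A)^[i] (fTest p s₀ R) s - h s|
        ≤ N * (brokenPower p α β s₀ s + brokenPower p α β R s) := by
  obtain ⟨N, hN, hb⟩ := iterate_hardyOp_bounds hp hm (hm.trans_le hmM) hA hAmono hs₀ hAM hα0 hα
    hβ hβ1 i
  have hp0 : 0 < 1 / p := by positivity
  have hp1 : 1 / p < 1 := hβ.trans hβ1
  have h1p : 0 < 1 - 1 / p := by linarith
  have h1α : 0 < 1 - α := by linarith
  have h1β : 0 < 1 - β := by linarith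
  have hβ0 : 0 < β := hp0.trans hβ
  have hLK : (1 / (1 / p * (1 - 1 / p) * M ^ 2)) ^ i ≤ (1 / (1 / p * (1 - 1 / p) * m ^ 2)) ^ i := by
    gcongr
  have hL0 : 0 ≤ (1 / (1 / p * (1 - 1 / p) * M ^ 2)) ^ i := by positivity
  have hKα : 0 ≤ (1 / (α * (1 - α) * m ^ 2)) ^ i := by positivity
  have hKβ : 0 ≤ (1 / (β * (1 - β) * m ^ 2)) ^ i := by positivity
  set L := (1 / (1 / p * (1 - 1 / p) * M ^ 2)) ^ i
  set K := (1 / (1 / p * (1 - 1 / p) * m ^ 2)) ^ i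
  set Kα := (1 / (α * (1 - α) * m ^ 2)) ^ i
  set Kβ := (1 / (β * (1 - β) * m ^ 2)) ^ i
  have hK0 : 0 ≤ K := hL0.trans hLK
  refine ⟨K + Kα + Kβ + N, by positivity, fun R hR => ?_⟩
  have hR0 : 0 < R := hs₀.trans hR
  obtain ⟨-, hb⟩ := hb R hR
  set v := (hardyOp A)^[i] (fTest p s₀ R)
  refine ⟨fun s => max (L * fTest p s₀ R s) (min (v s) (K * fTest p s₀ R s)), fun s hs => ?_⟩
  obtain ⟨hv0, hvp, hvα, hvβ, hvl⟩ := hb s hs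
  have hf0 := fTest_nonneg (p := p) hs₀ hR hs
  have hlohi : L * fTest p s₀ R s ≤ K * fTest p s₀ R s := by gcongr
  have hhi : max (L * fTest p s₀ R s) (min (v s) (K * fTest p s₀ R s)) ≤ K * fTest p s₀ R s :=
    max_le hlohi (min_le_right _ _)
  refine ⟨le_max_left _ _, hhi, ?_⟩
  beta_reduce
  have hh0 : 0 ≤ max (L * fTest p s₀ R s) (min (v s) (K * fTest p s₀ R s)) :=
    (mul_nonneg hL0 hf0).trans (le_max_left _ _)
  have hg1 := brokenPower_nonneg (p := p) (α := α) (β := β) hs₀ hs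
  have hg2 := brokenPower_nonneg (p := p) (α := α) (β := β) hR0 hs
  rcases lt_or_ge s s₀ with h | h
  · have e1 : brokenPower p α β s₀ s = s₀ ^ (α - 1 / p) * s ^ (-α) := if_pos h
    have h1 := mul_le_mul_of_nonneg_left
      (fTest_le_lower hs₀ hR hs hp0.le hp1.le hα0.le hα.le) hK0
    rw [mul_assoc] at hvα
    rw [← e1] at h1 hvα
    have hrest : 0 ≤ (Kβ + N) * brokenPower p α β s₀ s + (K + Kα + Kβ + N) * brokenPower p α β R s := by
      positivity
    rw [abs_le]
    constructor <;> linarith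
  rcases lt_or_ge s R with h' | h'
  · have e1 : brokenPower p α β s₀ s = s₀ ^ (β - 1 / p) * s ^ (-β) := if_neg h.not_gt
    have e2 : brokenPower p α β R s = R ^ (α - 1 / p) * s ^ (-α) := if_pos h'
    have ef : fTest p s₀ R s = s ^ (-(1 / p)) := by rw [fTest, if_neg h.not_gt, if_pos h']
    rw [mul_assoc N, mul_assoc N, ← e1, ← e2, ← ef] at hvl
    rw [← ef] at hvp
    have hrest : 0 ≤ (K + Kα + Kβ) * (brokenPower p α β s₀ s + brokenPower p α β R s) := by
      positivity
    have hrest' := mul_nonneg hN (add_nonneg hg1 hg2)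
    rw [min_eq_left hvp, abs_le]
    rcases max_cases (L * fTest p s₀ R s) (v s) with ⟨e, -⟩ | ⟨e, -⟩ <;> rw [e] <;>
      constructor <;> linarith [le_max_left (L * fTest p s₀ R s) (v s),
        le_max_right (L * fTest p s₀ R s) (v s)]
  · have e2 : brokenPower p α β R s = R ^ (β - 1 / p) * s ^ (-β) := if_neg h'.not_gt
    have h1 := mul_le_mul_of_nonneg_left
      (fTest_le_upper hs₀ hR hs hp0.le hβ.le hβ1.le) hK0
    rw [mul_assoc] at hvβ
    rw [← e2] at h1 hvβ
    have hrest : 0 ≤ (K + Kα + Kβ + N) * brokenPower p α β s₀ s + (Kα + N) * brokenPower p α β R s := by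
      positivity
    rw [abs_le]
    constructor <;> linarith

end Iterates

lemma add_rpow_le_two_rpow_mul {a b p : ℝ} (ha : 0 ≤ a) (hb : 0 ≤ b) (hp : 0 ≤ p) :
    (a + b) ^ p ≤ 2 ^ p * (a ^ p + b ^ p) := by
  calc (a + b) ^ p ≤ (2 * max a b) ^ p := by
        gcongr
        linarith [le_max_left a b, le_max_right a b]
    _ = 2 ^ p * max a b ^ p := Real.mul_rpow (by norm_num) (le_max_of_le_left ha)
    _ ≤ 2 ^ p * (a ^ p + b ^ p) := by
        gcongr
        rcases max_choice a b with h | h <;> rw [h]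
        · linarith [Real.rpow_nonneg hb p]
        · linarith [Real.rpow_nonneg ha p]

lemma lintegral_abs_rpow_le_of_brokenPower {w : ℝ → ℝ} {p α β N s₀ R : ℝ} (hp : 0 < p)
    (hα : α * p < 1) (hβ : 1 < β * p) (hN : 0 ≤ N) (hs₀ : 0 < s₀) (hR : 0 < R)
    (hw : ∀ s > 0, |w s| ≤ N * (brokenPower p α β s₀ s + brokenPower p α β R s)) :
    ∫⁻ s in Ioi 0, ENNReal.ofReal (|w s| ^ p) ≤ ENNReal.ofReal
      (N ^ p * 2 ^ p * (2 * (1 / (1 - α * p) + 1 / (β * p - 1)))) := by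
  have hD : 0 ≤ 1 / (1 - α * p) + 1 / (β * p - 1) := by bound
  have hc : 0 ≤ N ^ p * 2 ^ p := by positivity
  calc ∫⁻ s in Ioi 0, ENNReal.ofReal (|w s| ^ p)
      ≤ ∫⁻ s in Ioi 0, ENNReal.ofReal (N ^ p * 2 ^ p) *
        (ENNReal.ofReal (brokenPower p α β s₀ s ^ p)
          + ENNReal.ofReal (brokenPower p α β R s ^ p)) := by
        refine setLIntegral_mono' measurableSet_Ioi fun s hs => ?_
        have h1 := brokenPower_nonneg (p := p) (α := α) (β := β) hs₀ hs
        have h2 := brokenPower_nonneg (p := p) (α := α) (β := β) hR hs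
        rw [← ENNReal.ofReal_add (by positivity) (by positivity), ← ENNReal.ofReal_mul hc]
        refine ENNReal.ofReal_le_ofReal ?_
        calc |w s| ^ p ≤ (N * (brokenPower p α β s₀ s + brokenPower p α β R s)) ^ p := by
              gcongr
              exact hw s hs
          _ = N ^ p * (brokenPower p α β s₀ s + brokenPower p α β R s) ^ p :=
              Real.mul_rpow hN (by positivity)
          _ ≤ N ^ p * (2 ^ p * (brokenPower p α β s₀ s ^ p + brokenPower p α β R s ^ p)) := by
              gcongr
              exact add_rpow_le_two_rpow_mul h1 h2 hp.le
          _ = _ := by ring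
    _ ≤ _ := by
        rw [lintegral_const_mul' _ _ ENNReal.ofReal_ne_top,
          lintegral_add_left (measurable_brokenPower.pow_const p).ennreal_ofReal,
          ENNReal.ofReal_mul hc, two_mul, ENNReal.ofReal_add hD hD]
        gcongr
        · exact lintegral_brokenPower_rpow hp hs₀ hα hβ
        · exact lintegral_brokenPower_rpow hp hR hα hβ

lemma vIter_eq_iterate (n : ℕ) (p : ℝ) (F : ℝ → ℝ) (s₀ R : ℝ) (i : ℕ) :
    vIter n p F s₀ R i =
      (hardyOp fun t => n * unitBallVol n * Real.sinh (F t) ^ (n - 1))^[i] (fTest p s₀ R) := by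
  induction i with
  | zero => rfl
  | succ i ih =>
    rw [Function.iterate_succ_apply', ← ih]
    rfl

/-- Proposition `decomposefunction` of the paper: for each `i ≥ 1`
there is a constant `C > 0` independent of `R` such that for every `R > s₀` one can
decompose `v_{R,i} = h_{R,i} + w_{R,i}` with `∫_0^∞ |w_{R,i}|^p ≤ C` and
`(1+ε)^{-2i} (p p'/(n-1)²)^i f_R ≤ h_{R,i} ≤ (p p'/(n-1)²)^i f_R`. -/
theorem v_iter_decomposition (n : ℕ) (hn : 2 ≤ n) (p : ℝ) (hp : 1 < p)
    (F : ℝ → ℝ) (hF0 : ∀ s, 0 ≤ s → 0 ≤ F s)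
    (hF : ∀ s, 0 ≤ s →
      s = n * unitBallVol n * ∫ r in (0 : ℝ)..(F s), Real.sinh r ^ (n - 1))
    (ε : ℝ) (hε : 0 < ε) (s₀ : ℝ) (hs₀ : 0 < s₀)
    (hs₀F : ∀ s, s₀ ≤ s →
      ((n : ℝ) - 1) * s ≤ n * unitBallVol n * Real.sinh (F s) ^ (n - 1)
      ∧ n * unitBallVol n * Real.sinh (F s) ^ (n - 1) ≤ (1 + ε) * (((n : ℝ) - 1) * s)) :
    ∀ i : ℕ, 1 ≤ i → ∃ C > (0 : ℝ), ∀ R > s₀,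
      ∃ h w : ℝ → ℝ,
        (∀ s, vIter n p F s₀ R i s = h s + w s)
        ∧ (∫⁻ s in Set.Ioi (0 : ℝ), ENNReal.ofReal (|w s| ^ p)) ≤ ENNReal.ofReal C
        ∧ ∀ s > (0 : ℝ),
            ((1 + ε) ^ (2 * i))⁻¹ * (p * (p / (p - 1)) / ((n : ℝ) - 1) ^ 2) ^ i *
                fTest p s₀ R s ≤ h s
            ∧ h s ≤ (p * (p / (p - 1)) / ((n : ℝ) - 1) ^ 2) ^ i * fTest p s₀ R s := by
  intro i _
  have hp0 : 0 < p := by linarith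
  have hn' : (2 : ℝ) ≤ n := by exact_mod_cast hn
  have hm : 0 < (n : ℝ) - 1 := by linarith
  have h1p : 1 / p < 1 := (div_lt_one hp0).2 hp
  have hq0 : 0 < 1 / p := by positivity
  have hmM : (n : ℝ) - 1 ≤ (1 + ε) * ((n : ℝ) - 1) := by nlinarith
  obtain ⟨N, hN, hdec⟩ := exists_abs_sub_clamp_le (α := 1 / p / 2) (β := (1 / p + 1) / 2)
    hp hm hmM (fun t ht => le_weight hn hF0 hF (le_of_lt ht)) (monotoneOn_weight hn hF0 hF) hs₀
    (fun t ht => (hs₀F t ht).2.trans_eq (mul_assoc _ _ _).symm)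
    (by linarith) (by linarith) (by linarith) (by linarith) i
  have hα : 1 / p / 2 * p < 1 := by
    field_simp
    norm_num
  have hβ : 1 < (1 / p + 1) / 2 * p := by
    field_simp
    linarith
  have hα' : 0 < 1 - 1 / p / 2 * p := by linarith
  have hβ' : 0 < (1 / p + 1) / 2 * p - 1 := by linarith
  have hK : 1 / (1 / p * (1 - 1 / p) * ((n : ℝ) - 1) ^ 2)
      = p * (p / (p - 1)) / ((n : ℝ) - 1) ^ 2 := by
    have : p - 1 ≠ 0 := by linarith
    field_simp
  have hL : (1 / (1 / p * (1 - 1 / p) * ((1 + ε) * ((n : ℝ) - 1)) ^ 2)) ^ i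
      = ((1 + ε) ^ (2 * i))⁻¹ * (p * (p / (p - 1)) / ((n : ℝ) - 1) ^ 2) ^ i := by
    rw [← hK, pow_mul, ← inv_pow, ← mul_pow]
    congr 1
    rw [mul_pow]
    field_simp
  rw [hK, hL] at hdec
  refine ⟨N ^ p * 2 ^ p * (2 * (1 / (1 - 1 / p / 2 * p) + 1 / ((1 / p + 1) / 2 * p - 1))) + 1,
    by positivity, fun R hR => ?_⟩
  obtain ⟨h, hh⟩ := hdec R hR
  rw [vIter_eq_iterate]
  refine ⟨h, fun s => _ - h s, fun s => (add_sub_cancel _ _).symm, ?_,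
    fun s hs => ⟨(hh s hs).1, (hh s hs).2.1⟩⟩
  exact (lintegral_abs_rpow_le_of_brokenPower hp0 hα hβ hN hs₀ (hs₀.trans hR)
    fun s hs => (hh s hs).2.2).trans (ENNReal.ofReal_le_ofReal (by linarith))
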